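/- arXiv:2601.04871 — 2 statements merged into one kernel-verified Lean document; each statement's English description precedes it below -/
import Mathlib

section
/- Let f be a postcritically finite polynomial of degree d ≥ 2 with postcritical set P_f, and let 𝓕 be a finite family of separating arcs such that f is injective on each arc L ∈ 𝓕 and the assignment L ↦ f(L) is a bijection from 𝓕 onto 𝓕. Then for every simple closed curve C ⊆ ℂ \ P_f and every component C′ of f^{-1}(C), one has N_𝓕(C′) ≤ N_𝓕(C) (an inequality in [0, ∞]). -/
open Set Topology ENNReal

noncomputable section

/-- Iterate of the evaluation map of a polynomial. -/
def pIter (p : Polynomial ℂ) (n : ℕ) : ℂ → ℂ := (fun z => p.eval z)^[n]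

/-- The postcritical set of a polynomial. -/
def PostCritical (p : Polynomial ℂ) : Set ℂ :=
  ⋃ n : ℕ, pIter p (n + 1) '' {z : ℂ | p.derivative.eval z = 0}

/-- `C` is a simple closed curve contained in the complement of `P`. -/
def IsSCC (P C : Set ℂ) : Prop :=
  ∃ γ : C(Circle, ℂ), Function.Injective γ ∧ Set.range γ = C ∧ ∀ x, γ x ∉ P

/-- Two simple closed curves are (freely) homotopic in `ℂ \ P`. -/
def HomotopicIn (P C C' : Set ℂ) : Prop :=
  ∃ γ γ' : C(Circle, ↥(Pᶜ)),
    Function.Injective γ ∧ Function.Injective γ' ∧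
    Set.range (fun x => (γ x : ℂ)) = C ∧ Set.range (fun x => (γ' x : ℂ)) = C' ∧
    Nonempty (γ.Homotopy γ')

/-- A separating arc: image of a continuous injective proper map `ℝ → ℂ`. -/
def IsSepArc (L : Set ℂ) : Prop :=
  ∃ φ : ℝ → ℂ, Continuous φ ∧ Function.Injective φ ∧ IsProperMap φ ∧ Set.range φ = L

/-- Complexity of `C` with respect to the family `F`, in `[0,∞]`. -/
def complexity (P : Set ℂ) (F : Finset (Set ℂ)) (C : Set ℂ) : ℝ≥0∞ :=
  ⨅ (γ : Set ℂ) (_ : IsSCC P γ ∧ HomotopicIn P γ C),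
    ∑ L ∈ F, ((γ ∩ L).encard : ℝ≥0∞)

/-- Each component of the complement of the union of the arcs contains at most one
point of `P`. -/
def CondOne (P : Set ℂ) (F : Finset (Set ℂ)) : Prop :=
  ∀ z ∈ (⋃ L ∈ F, L)ᶜ,
    (connectedComponentIn (⋃ L ∈ F, (L : Set ℂ))ᶜ z ∩ P).Subsingleton

/-- Any two arcs of the family are disjoint or intersect only at points of `P`. -/
def CondTwo (P : Set ℂ) (F : Finset (Set ℂ)) : Prop :=
  ∀ L ∈ F, ∀ L' ∈ F, L ≠ L' → L ∩ L' ⊆ P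

/-- An admissible family of separating arcs. -/
def Admissible (P : Set ℂ) (F : Finset (Set ℂ)) : Prop :=
  (∀ L ∈ F, IsSepArc L) ∧ CondOne P F ∧ CondTwo P F ∧
    ∀ F' ⊂ F, ¬ (CondOne P F' ∧ CondTwo P F')

/-- `η` is a connected component of the set `S`. -/
def IsCompOf (η S : Set ℂ) : Prop := ∃ z ∈ S, η = connectedComponentIn S z

end

section Covering

variable {E X : Type*} [TopologicalSpace E] [TopologicalSpace X] {q : E → X} {c : C(Circle, X)}

/-- Two lifts to a covering space of the universal cover of an embedded circle that meet are
translates of each other. -/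
theorem IsCoveringMap.lift_circle_translate (hq : IsCoveringMap q) (hc : Function.Injective c)
    {G G' : ℝ → E} (hG : Continuous G) (hG' : Continuous G')
    (hqG : ∀ x, q (G x) = c (Circle.exp x)) (hqG' : ∀ x, q (G' x) = c (Circle.exp x))
    {s t : ℝ} (hst : G s = G' t) :
    Circle.exp (s - t) = 1 ∧ ∀ x, G (x + (s - t)) = G' x := by
  have h1 : Circle.exp (s - t) = 1 := by
    have : c (Circle.exp s) = c (Circle.exp t) := by rw [← hqG, ← hqG', hst]
    rw [Circle.exp_sub, hc this, div_self']
  refine ⟨h1, fun x ↦ congr_fun (hq.eq_of_comp_eq (g₁ := fun x ↦ G (x + (s - t)))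
    (hG.comp (by fun_prop)) hG' ?_ t (by simpa using hst)) x⟩
  ext x
  simp [hqG, hqG', Circle.exp_add, h1]

theorem IsCoveringMap.range_lift_circle_eq (hq : IsCoveringMap q) (hc : Function.Injective c)
    {G G' : ℝ → E} (hG : Continuous G) (hG' : Continuous G')
    (hqG : ∀ x, q (G x) = c (Circle.exp x)) (hqG' : ∀ x, q (G' x) = c (Circle.exp x))
    (h : (range G ∩ range G').Nonempty) : range G = range G' := by
  obtain ⟨_, ⟨s, rfl⟩, t, ht⟩ := h
  have key := (hq.lift_circle_translate hc hG hG' hqG hqG' ht.symm).2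
  ext y
  constructor
  · rintro ⟨x, rfl⟩
    exact ⟨x - (s - t), by rw [← key]; simp⟩
  · rintro ⟨x, rfl⟩
    exact ⟨_, key x⟩

theorem IsCoveringMap.exists_lift_circle_exp (hq : IsCoveringMap q) (e : E) (t : ℝ)
    (he : q e = c (Circle.exp t)) :
    ∃ G : ℝ → E, Continuous G ∧ (∀ x, q (G x) = c (Circle.exp x)) ∧ G t = e := by
  obtain ⟨G, ⟨h0, h1⟩, -⟩ := hq.existsUnique_continuousMap_lifts
    (c.comp ⟨Circle.exp, by fun_prop⟩) t e he
  exact ⟨G, G.continuous, fun x ↦ congr_fun h1 x, h0⟩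

/-- A lift along the universal cover of an embedded circle factors through an embedded circle,
when the covering map has finite fibers. -/
theorem IsCoveringMap.exists_circle_of_lift (hq : IsCoveringMap q) (hc : Function.Injective c)
    (hfin : ∀ x, (q ⁻¹' {x}).Finite) {G : ℝ → E} (hG : Continuous G)
    (hqG : ∀ x, q (G x) = c (Circle.exp x)) :
    ∃ (k : ℕ) (g : C(Circle, E)), Function.Injective g ∧ (∀ z, q (g z) = c (z ^ k)) ∧
      range g = range G := by
  have hpi : (2 * Real.pi) ≠ 0 := by positivity
  let H : AddSubgroup ℤ :=
    { carrier := {n | Function.Periodic G (n * (2 * Real.pi))}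
      add_mem' := fun {a b} ha hb ↦ by
        have := Function.Periodic.add_period ha hb
        simpa [add_mul] using this
      zero_mem' := by simp [Function.Periodic]
      neg_mem' := fun {a} ha ↦ by
        have := Function.Periodic.neg ha
        simpa using this }
  have memH (n : ℤ) : n ∈ H ↔ Function.Periodic G (n * (2 * Real.pi)) := Iff.rfl
  have per {s t : ℝ} (h : G s = G t) : ∃ n ∈ H, s - t = n * (2 * Real.pi) := by
    obtain ⟨h1, h2⟩ := hq.lift_circle_translate hc hG hG hqG hqG h
    obtain ⟨n, hn⟩ := Circle.exp_eq_one.1 h1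
    exact ⟨n, (memH n).2 (hn ▸ h2), hn⟩
  obtain ⟨a, ha⟩ := Int.subgroup_cyclic H
  rw [← AddSubgroup.zmultiples_eq_closure] at ha
  have ha0 : a ≠ 0 := by
    rintro rfl
    have hinj : Function.Injective fun n : ℕ ↦ G (n * (2 * Real.pi)) := by
      intro m n hmn
      obtain ⟨j, hj, hj'⟩ := per hmn
      rw [ha] at hj
      obtain rfl : j = 0 := by simpa using hj
      have : (m : ℝ) * (2 * Real.pi) = n * (2 * Real.pi) := by simpa [sub_eq_zero] using hj'
      exact_mod_cast mul_right_cancel₀ hpi this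
    refine Set.infinite_range_of_injective hinj ((hfin (c 1)).subset ?_)
    rintro _ ⟨n, rfl⟩
    simp only [mem_preimage, mem_singleton_iff, hqG]
    rw [Circle.exp_eq_one.2 ⟨n, by simp⟩]
  set k := a.natAbs with hk
  have hk0 : (k : ℝ) ≠ 0 := by simpa [hk] using ha0
  have hHk (n : ℤ) : n ∈ H ↔ ∃ m : ℤ, n = m * k := by
    rw [ha, Int.mem_zmultiples_iff, ← Int.natAbs_dvd, ← hk, dvd_iff_exists_eq_mul_left]
  have hper : Function.Periodic (fun x ↦ G (k * x)) (2 * Real.pi) := fun x ↦ by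
    have := (memH k).1 ((hHk k).2 ⟨1, by simp⟩) (k * x)
    simpa [mul_add] using this
  let g : C(Circle, E) :=
    ⟨fun z ↦ hper.lift (AddCircle.homeomorphCircle'.symm z), by
      refine Continuous.comp ?_ AddCircle.homeomorphCircle'.symm.continuous
      exact continuous_quot_lift _ (hG.comp (by fun_prop))⟩
  have hg (x : ℝ) : g (Circle.exp x) = G (k * x) := by
    change hper.lift (AddCircle.homeomorphCircle'.symm (Circle.exp x)) = _
    rw [← AddCircle.homeomorphCircle'_apply_mk, Homeomorph.symm_apply_apply]
    rfl
  have surj (z : Circle) : ∃ x : ℝ, Circle.exp x = z := ⟨_, Circle.exp_arg z⟩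
  refine ⟨k, g, ?_, ?_, ?_⟩
  · intro z w hzw
    obtain ⟨x, rfl⟩ := surj z
    obtain ⟨y, rfl⟩ := surj w
    rw [hg, hg] at hzw
    obtain ⟨n, hn, hn'⟩ := per hzw
    obtain ⟨m, rfl⟩ := (hHk n).1 hn
    refine Circle.exp_eq_exp.2 ⟨m, ?_⟩
    push_cast at hn'
    apply mul_left_cancel₀ hk0
    linear_combination hn'
  · intro z
    obtain ⟨x, rfl⟩ := surj z
    rw [hg, hqG, ← Circle.exp_natCast_mul]
  · ext y
    constructor
    · rintro ⟨z, rfl⟩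
      obtain ⟨x, rfl⟩ := surj z
      exact ⟨_, (hg x).symm⟩
    · rintro ⟨x, rfl⟩
      refine ⟨Circle.exp (x / k), ?_⟩
      rw [hg, mul_div_cancel₀ _ hk0]

/-- Through every point over an embedded circle passes an embedded circle which is clopen in
the preimage, when the covering map has finite fibers. -/
theorem IsCoveringMap.exists_circle_through (hq : IsCoveringMap q) (hc : Function.Injective c)
    (hfin : ∀ x, (q ⁻¹' {x}).Finite) (e : E) (he : q e ∈ range c) :
    ∃ (k : ℕ) (g : C(Circle, E)), Function.Injective g ∧ (∀ z, q (g z) = c (z ^ k)) ∧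
      e ∈ range g ∧ IsCompact (q ⁻¹' range c \ range g) := by
  have lifts (y : E) (hy : q y ∈ range c) :
      ∃ G : ℝ → E, Continuous G ∧ (∀ x, q (G x) = c (Circle.exp x)) ∧ y ∈ range G := by
    obtain ⟨z, hz⟩ := hy
    obtain ⟨G, h1, h2, h3⟩ := hq.exists_lift_circle_exp (c := c) y (Complex.arg z)
      (by rw [Circle.exp_arg, hz])
    exact ⟨G, h1, h2, _, h3⟩
  choose! L Lcont Llift Lmem using lifts
  have Lcompact (y : E) (hy : q y ∈ range c) : IsCompact (range (L y)) := by
    obtain ⟨k, g, -, -, hg⟩ := hq.exists_circle_of_lift hc hfin (Lcont y hy) (Llift y hy)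
    exact hg ▸ isCompact_range g.continuous
  have Leq (y y' : E) (hy : q y ∈ range c) (hy' : q y' ∈ range c) (h : y ∈ range (L y')) :
      range (L y) = range (L y') :=
    hq.range_lift_circle_eq hc (Lcont y hy) (Lcont y' hy') (Llift y hy) (Llift y' hy')
      ⟨y, Lmem y hy, h⟩
  obtain ⟨k, g, ginj, glift, grange⟩ :=
    hq.exists_circle_of_lift hc hfin (Lcont e he) (Llift e he)
  refine ⟨k, g, ginj, glift, grange ▸ Lmem e he, ?_⟩
  rw [grange]
  have hS : q ⁻¹' range c \ range (L e) =
      ⋃ w ∈ q ⁻¹' {c 1} \ range (L e), range (L w) := by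
    ext y
    simp only [mem_iUnion, exists_prop]
    constructor
    · rintro ⟨hy, hye⟩
      have h0 : q (L y 0) = c 1 := by simpa using Llift y hy 0
      have h0c : q (L y 0) ∈ range c := ⟨1, h0.symm⟩
      have h1 := Leq (L y 0) y h0c hy ⟨0, rfl⟩
      refine ⟨L y 0, ⟨h0, fun h ↦ hye ?_⟩, h1 ▸ Lmem y hy⟩
      rw [← Leq _ _ h0c he h, h1]
      exact Lmem y hy
    · rintro ⟨w, ⟨hw, hwe⟩, hy⟩
      have hwc : q w ∈ range c := ⟨1, hw.symm⟩
      have hyc : q y ∈ range c := by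
        obtain ⟨x, rfl⟩ := hy
        exact ⟨_, (Llift w hwc x).symm⟩
      refine ⟨hyc, fun h ↦ hwe ?_⟩
      rw [← Leq y e hyc he h, Leq y w hyc hwc hy]
      exact Lmem w hwc
  rw [hS]
  exact ((hfin _).subset sdiff_subset).isCompact_biUnion fun w hw ↦ Lcompact w ⟨1, hw.1.symm⟩

/-- A homotopy between embedded circles lifts to a homotopy of embedded circles. -/
theorem IsCoveringMap.exists_homotopy_circle (hq : IsCoveringMap q) {c' : C(Circle, X)}
    (hc' : Function.Injective c') (H : c'.Homotopy c) {k : ℕ} {g : C(Circle, E)}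
    (hg : Function.Injective g) (hqg : ∀ z, q (g z) = c (z ^ k)) :
    ∃ h : C(Circle, E), Function.Injective h ∧ (∀ z, q (h z) = c' (z ^ k)) ∧
      Nonempty (h.Homotopy g) := by
  let K : C(unitInterval × Circle, X) :=
    H.symm.toContinuousMap.comp ⟨fun x ↦ (x.1, x.2 ^ k), by fun_prop⟩
  have hK (t : unitInterval) (z : Circle) : K (t, z) = H.symm (t, z ^ k) := rfl
  have hK0 (z : Circle) : K (0, z) = q (g z) := by rw [hK, hqg]; simp
  let M := hq.liftHomotopy K g hK0
  have hM (x : unitInterval × Circle) : q (M x) = K x :=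
    congr_fun (hq.liftHomotopy_lifts K g hK0) x
  have hM0 (z : Circle) : M (0, z) = g z := hq.liftHomotopy_zero K g hK0 z
  let h : C(Circle, E) := M.comp ⟨fun z ↦ (1, z), by fun_prop⟩
  have hqh (z : Circle) : q (h z) = c' (z ^ k) := by
    change q (M (1, z)) = _
    rw [hM, hK]; simp
  refine ⟨h, fun z w hzw ↦ ?_, hqh, ⟨ContinuousMap.Homotopy.symm ⟨M, hM0, fun _ ↦ rfl⟩⟩⟩
  have hpow : z ^ k = w ^ k := hc' (by rw [← hqh, ← hqh, hzw])
  have := hq.eq_of_comp_eq (g₁ := fun t ↦ M (t, z)) (g₂ := fun t ↦ M (t, w))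
    (M.continuous.comp (by fun_prop)) (M.continuous.comp (by fun_prop))
    (by ext t; simp [hM, hK, hpow]) 1 hzw
  exact hg (by rw [← hM0, ← hM0]; exact congr_fun this 0)

end Covering

theorem eval_mem_postCritical {p : Polynomial ℂ} {z : ℂ} (hz : z ∈ PostCritical p) :
    p.eval z ∈ PostCritical p := by
  obtain ⟨n, w, hw, rfl⟩ := mem_iUnion.1 hz
  refine mem_iUnion.2 ⟨n + 1, w, hw, ?_⟩
  simp only [pIter]
  rw [Function.iterate_succ_apply' _ (n + 1)]

theorem isCoveringMap_eval_compl_postCritical (p : Polynomial ℂ) :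
    IsCoveringMap ((PostCritical p)ᶜ.restrictPreimage p.eval) := by
  refine (p.isCoveringMapOn_eval.mono (compl_subset_compl.2 ?_)).isCoveringMap_restrictPreimage
  rintro _ ⟨z, hz, rfl⟩
  exact mem_iUnion.2 ⟨0, z, hz, rfl⟩

/-- A subset of `S` that is preconnected and meets `A` lies in `A`, if `A` and `S \ A` are closed. -/
theorem IsPreconnected.subset_of_isClosed_diff {α : Type*} [TopologicalSpace α] {T S A : Set α}
    (hT : IsPreconnected T) (hTS : T ⊆ S) (hA : IsClosed A) (hSA : IsClosed (S \ A))
    (h : (T ∩ A).Nonempty) : T ⊆ A := by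
  intro x hx
  by_contra hxA
  obtain ⟨y, -, hy, hy'⟩ := isPreconnected_closed_iff.1 hT A (S \ A) hA hSA
    (fun y hy ↦ by by_cases hyA : y ∈ A <;> simp [hyA, hTS hy]) h ⟨x, hx, hTS hx, hxA⟩
  exact hy'.2 hy

theorem sum_encard_le_of_image {F : Finset (Set ℂ)} {f : ℂ → ℂ} {η γ : Set ℂ}
    (hη : MapsTo f η γ) (hinj : ∀ L ∈ F, InjOn f L) (himg : ∀ L ∈ F, f '' L ∈ F)
    (himg_inj : ∀ L ∈ F, ∀ L' ∈ F, f '' L = f '' L' → L = L')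
    (himg_surj : ∀ L ∈ F, ∃ L' ∈ F, f '' L' = L) :
    ∑ L ∈ F, ((η ∩ L).encard : ℝ≥0∞) ≤ ∑ L ∈ F, ((γ ∩ L).encard : ℝ≥0∞) := by
  calc ∑ L ∈ F, ((η ∩ L).encard : ℝ≥0∞)
      ≤ ∑ L ∈ F, ((γ ∩ f '' L).encard : ℝ≥0∞) := by
        refine Finset.sum_le_sum fun L hL ↦ ENat.toENNReal_le.2 ?_
        rw [← ((hinj L hL).mono inter_subset_right).encard_image]
        refine encard_le_encard ?_
        rintro _ ⟨x, ⟨hx, hxL⟩, rfl⟩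
        exact ⟨hη hx, x, hxL, rfl⟩
    _ = ∑ L ∈ F, ((γ ∩ L).encard : ℝ≥0∞) :=
        Finset.sum_nbij (fun L ↦ f '' L) himg (fun L hL L' hL' ↦ himg_inj L hL L' hL')
          (fun L hL ↦ himg_surj L hL) fun _ _ ↦ rfl

/-- Curves homotopic to `C` lift to curves homotopic to a given component of the preimage. -/
theorem exists_homotopicIn_preimage {p : Polynomial ℂ} (hp : 0 < p.natDegree) {C C' γ : Set ℂ}
    (hγ : HomotopicIn (PostCritical p) γ C) (hC' : IsCompOf C' (p.eval ⁻¹' C)) :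
    ∃ η, IsSCC (PostCritical p) η ∧ HomotopicIn (PostCritical p) η C' ∧ MapsTo p.eval η γ := by
  obtain ⟨c', c, hc', hc, rfl, rfl, ⟨H⟩⟩ := hγ
  obtain ⟨z, ⟨u, hu⟩, rfl⟩ := hC'
  let q := (PostCritical p)ᶜ.restrictPreimage p.eval
  have hq : IsCoveringMap q := isCoveringMap_eval_compl_postCritical p
  have hfin (x : ↥(PostCritical p)ᶜ) : (q ⁻¹' {x}).Finite := by
    have hne : p ≠ Polynomial.C (x : ℂ) := by
      intro h
      rw [h] at hp
      simp at hp
    have h1 : (p.eval ⁻¹' {(x : ℂ)}).Finite := by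
      rw [Polynomial.preimage_eval_singleton hne]
      exact Polynomial.rootSet_finite ..
    refine Set.Finite.subset (h1.preimage Subtype.val_injective.injOn) fun y hy ↦ ?_
    exact congr_arg Subtype.val hy
  have hz : z ∈ p.eval ⁻¹' (PostCritical p)ᶜ :=
    mem_preimage.2 (mem_of_eq_of_mem hu.symm (c u).2)
  obtain ⟨k, g, ginj, glift, ⟨v, hv⟩, gcpt⟩ :=
    hq.exists_circle_through hc hfin ⟨z, hz⟩ ⟨u, Subtype.ext hu⟩
  obtain ⟨h, hinj, hlift, ⟨M⟩⟩ := hq.exists_homotopy_circle hc' H ginj glift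
  let ι : C(p.eval ⁻¹' (PostCritical p)ᶜ, ↥(PostCritical p)ᶜ) :=
    ⟨fun y ↦ ⟨y, fun hy ↦ y.2 (eval_mem_postCritical hy)⟩, by fun_prop⟩
  have hι : Function.Injective ι := fun a b hab ↦ Subtype.ext (congr_arg (fun x ↦ x.1) hab)
  have hcomp : range (fun x ↦ (g x : ℂ)) =
      connectedComponentIn (p.eval ⁻¹' range fun x ↦ (c x : ℂ)) z := by
    have hgc : Continuous fun x ↦ (g x : ℂ) := by fun_prop
    have hzg : z ∈ range fun x ↦ (g x : ℂ) := ⟨v, congr_arg Subtype.val hv⟩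
    have hzS : z ∈ p.eval ⁻¹' range fun x ↦ (c x : ℂ) := ⟨u, hu⟩
    refine Subset.antisymm ?_ ?_
    · refine (isPreconnected_range hgc).subset_connectedComponentIn hzg ?_
      rintro _ ⟨x, rfl⟩
      exact ⟨_, congr_arg Subtype.val (glift x).symm⟩
    · refine isPreconnected_connectedComponentIn.subset_of_isClosed_diff
        (connectedComponentIn_subset _ _) (isCompact_range hgc).isClosed ?_
        ⟨z, mem_connectedComponentIn hzS, hzg⟩
      convert (gcpt.image continuous_subtype_val).isClosed using 1
      ext y
      constructor
      · rintro ⟨⟨x, hx⟩, hy⟩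
        have hyP : y ∈ p.eval ⁻¹' (PostCritical p)ᶜ :=
          mem_preimage.2 (mem_of_eq_of_mem hx.symm (c x).2)
        exact ⟨⟨y, hyP⟩, ⟨⟨x, Subtype.ext hx⟩, fun ⟨w, hw⟩ ↦ hy ⟨w, by simp [hw]⟩⟩, rfl⟩
      · rintro ⟨y, ⟨⟨x, hx⟩, hy⟩, rfl⟩
        exact ⟨⟨x, congr_arg Subtype.val hx⟩, fun ⟨w, hw⟩ ↦ hy ⟨w, Subtype.ext hw⟩⟩
  refine ⟨range fun x ↦ (h x : ℂ), ⟨⟨fun x ↦ (h x : ℂ), by fun_prop⟩,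
    fun a b hab ↦ hinj (Subtype.ext hab), rfl, fun x ↦ (ι (h x)).2⟩,
    ⟨ι.comp h, ι.comp g, hι.comp hinj, hι.comp ginj, rfl, hcomp,
      ⟨(ContinuousMap.Homotopy.refl ι).comp M⟩⟩, ?_⟩
  rintro _ ⟨x, rfl⟩
  exact ⟨_, congr_arg Subtype.val (hlift x).symm⟩

theorem stmt10 (p : Polynomial ℂ) (d : ℕ) (hd : 2 ≤ d) (hdeg : p.natDegree = d)
    (hpcf : (PostCritical p).Finite)
    (F : Finset (Set ℂ)) (harc : ∀ L ∈ F, IsSepArc L)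
    (hinj : ∀ L ∈ F, Set.InjOn (fun z => p.eval z) L)
    (himg : ∀ L ∈ F, (fun z => p.eval z) '' L ∈ F)
    (himg_inj : ∀ L ∈ F, ∀ L' ∈ F,
      (fun z => p.eval z) '' L = (fun z => p.eval z) '' L' → L = L')
    (himg_surj : ∀ L ∈ F, ∃ L' ∈ F, (fun z => p.eval z) '' L' = L) :
    ∀ C : Set ℂ, IsSCC (PostCritical p) C →
      ∀ C' : Set ℂ, IsCompOf C' (pIter p 1 ⁻¹' C) →
        complexity (PostCritical p) F C' ≤ complexity (PostCritical p) F C := by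
  intro C _ C' hC'
  refine le_iInf₂ fun γ hγ ↦ ?_
  obtain ⟨η, hη, hηC', hmaps⟩ := exists_homotopicIn_preimage (by omega) hγ.2 hC'
  exact (iInf₂_le η ⟨hη, hηC'⟩).trans
    (sum_encard_le_of_image hmaps hinj himg himg_inj himg_surj)
end

section
/- Let f be a postcritically finite polynomial of degree d ≥ 2 with postcritical set P_f, let C and C″ be simple closed curves in ℂ \ P_f that are homotopic in ℂ \ P_f, and let n ≥ 1. Then for every component η of f^{-n}(C) there exists a component η″ of f^{-n}(C″) such that η and η″ are homotopic in ℂ \ P_f. -/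
open Set Topology ENNReal

namespace IsCoveringMapOn

variable {E X : Type*} [TopologicalSpace E] [TopologicalSpace X] {q : E → X} {s : Set X}

/-- Two lifts of the same map on `ℝ` that agree at a point are equal. -/
theorem lift_real_unique (hq : IsCoveringMapOn q s) {F G : ℝ → E}
    (hF : Continuous F) (hG : Continuous G) (h : ∀ t, q (F t) = q (G t)) (hs : ∀ t, q (F t) ∈ s)
    (a : ℝ) (ha : F a = G a) : F = G := by
  have hc : Continuous fun t => q (F t) :=
    continuous_iff_continuousAt.2 fun t => (hq.continuousAt (hs t)).comp hF.continuousAt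
  have hu := (hq.existsUnique_continuousMap_lifts ⟨fun t => q (F t), hc⟩ (a₀ := a) (e₀ := F a)
    rfl hs).unique (y₁ := ⟨F, hF⟩) (y₂ := ⟨G, hG⟩) ⟨rfl, rfl⟩
    ⟨ha.symm, funext fun t => (h t).symm⟩
  exact congrArg DFunLike.coe hu

/-- The homotopy lifting property for maps that are coverings over a subset. -/
theorem exists_homotopy_lift (hq : IsCoveringMapOn q s) {A : Type*} [TopologicalSpace A]
    (H : C(unitInterval × A, X)) (hs : ∀ x, H x ∈ s) (f : C(A, E))
    (h0 : ∀ a, H (0, a) = q (f a)) :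
    ∃ G : C(unitInterval × A, E), (∀ x, q (G x) = H x) ∧ ∀ a, G (0, a) = f a := by
  have cov := hq.isCoveringMap_restrictPreimage
  let H' : C(unitInterval × A, s) := ⟨fun x => ⟨H x, hs x⟩, by fun_prop⟩
  let f' : C(A, q ⁻¹' s) :=
    ⟨fun a => ⟨f a, by rw [mem_preimage, ← h0]; exact hs _⟩, by fun_prop⟩
  have h0' : ∀ a, H' (0, a) = s.restrictPreimage q (f' a) := fun a => Subtype.ext (h0 a)
  refine ⟨⟨fun x => (cov.liftHomotopy H' f' h0' x).1, by fun_prop⟩, fun x => ?_, fun a => ?_⟩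
  · exact congrArg Subtype.val (congrFun (cov.liftHomotopy_lifts H' f' h0') x)
  · exact congrArg Subtype.val (cov.liftHomotopy_zero H' f' h0' a)

/-- Through every point over an injective loop passes an injective loop covering it
with some finite degree. -/
theorem exists_circle_lift (hq : IsCoveringMapOn q s) (hfin : ∀ x ∈ s, (q ⁻¹' {x}).Finite)
    {γ : C(Circle, X)} (hγ : Function.Injective γ) (hs : ∀ z, γ z ∈ s)
    {e : E} (he : q e ∈ range γ) :
    ∃ (k : ℕ) (η : C(Circle, E)), k ≠ 0 ∧ Function.Injective η ∧
      (∀ z, q (η z) = γ (z ^ k)) ∧ e ∈ range η := by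
  obtain ⟨z₀, hz₀⟩ := he
  obtain ⟨t₀, rfl⟩ := Circle.exp_surjective z₀
  obtain ⟨F, ⟨hF₀, hF⟩, -⟩ := hq.existsUnique_continuousMap_lifts
    (γ.comp Circle.exp) (a₀ := t₀) (e₀ := e) hz₀.symm (fun t => hs _)
  replace hF : ∀ t, q (F t) = γ (Circle.exp t) := fun t => congrFun hF t
  have hper : ∀ (m : ℤ) (t : ℝ), F (t + m * (2 * Real.pi)) = F t →
      Function.Periodic F (m * (2 * Real.pi)) := fun m t ht => congrFun <|
    hq.lift_real_unique (F := fun u => F (u + m * (2 * Real.pi))) (by fun_prop) F.continuous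
      (fun u => by rw [hF, hF, Circle.exp_add, Circle.exp_int_mul_two_pi, mul_one])
      (fun u => by rw [hF]; exact hs _) t ht
  let K : AddSubgroup ℤ :=
    { carrier := {m | Function.Periodic F (m * (2 * Real.pi))}
      zero_mem' := fun t => by simp
      add_mem' := fun {a b} ha hb => by
        have := Function.Periodic.add_period ha hb
        simpa [add_mul] using this
      neg_mem' := fun {a} ha => by
        have := Function.Periodic.neg ha
        simpa [neg_mul] using this }
  obtain ⟨g, hg⟩ := Int.subgroup_cyclic K
  have hmem : ∀ m : ℤ, Function.Periodic F (m * (2 * Real.pi)) ↔ g ∣ m := fun m => by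
    change m ∈ K ↔ _
    rw [hg, AddSubgroup.mem_closure_singleton]
    simp [dvd_def, mul_comm, eq_comm]
  have hg0 : g ≠ 0 := by
    rintro rfl
    obtain ⟨i, -, j, -, hij, h⟩ := Set.infinite_univ.exists_ne_map_eq_of_mapsTo
      (f := fun i : ℤ => F (t₀ + i * (2 * Real.pi))) (t := q ⁻¹' {q e})
      (fun i _ => by
        simp [hF, Circle.exp_add, hz₀]) (hfin _ (hz₀ ▸ hs _))
    have := (hmem (j - i)).1 (hper (j - i) (t₀ + i * (2 * Real.pi)) (by
      push_cast
      rw [show t₀ + i * (2 * Real.pi) + (j - i) * (2 * Real.pi) = t₀ + j * (2 * Real.pi) by ring]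
      exact h.symm))
    rw [zero_dvd_iff] at this
    omega
  have hk0 : g.natAbs ≠ 0 := by simpa using hg0
  have hkR : (g.natAbs : ℝ) ≠ 0 := by exact_mod_cast hk0
  have hperk : Function.Periodic (fun t : ℝ => F (g.natAbs * t)) (2 * Real.pi) := fun t => by
    have := (hmem (g.natAbs : ℤ)).2 (by simp) (g.natAbs * t)
    simpa [mul_add] using this
  have hliftc : Continuous hperk.lift :=
    continuous_coinduced_dom.2 (F.continuous.comp (continuous_const.mul continuous_id))
  let η : C(Circle, E) := ⟨fun z => hperk.lift (AddCircle.homeomorphCircle'.symm z),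
    hliftc.comp AddCircle.homeomorphCircle'.symm.continuous⟩
  have hη : ∀ t, η (Circle.exp t) = F (g.natAbs * t) := fun t => by
    change hperk.lift (AddCircle.homeomorphCircle'.symm (Circle.exp t)) = _
    rw [← AddCircle.homeomorphCircle'_apply_mk, Homeomorph.symm_apply_apply]
    rfl
  have hexp : ∀ t : ℝ, Circle.exp (g.natAbs * t) = Circle.exp t ^ g.natAbs := fun t => by
    rw [← nsmul_eq_mul, Circle.exp_nsmul]
  refine ⟨g.natAbs, η, hk0, fun z w hzw => ?_, fun z => ?_, Circle.exp (t₀ / g.natAbs), ?_⟩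
  · obtain ⟨a, rfl⟩ := Circle.exp_surjective z
    obtain ⟨b, rfl⟩ := Circle.exp_surjective w
    rw [hη, hη] at hzw
    have h := congrArg q hzw
    rw [hF, hF] at h
    obtain ⟨m, hm⟩ := Circle.exp_eq_exp.1 (hγ h)
    rw [hm] at hzw
    obtain ⟨c, rfl⟩ := Int.natAbs_dvd.2 ((hmem m).1 (hper m _ hzw))
    refine Circle.exp_eq_exp.2 ⟨c, mul_left_cancel₀ hkR ?_⟩
    rw [hm, Int.cast_mul, Int.cast_natCast]
    ring
  · obtain ⟨t, rfl⟩ := Circle.exp_surjective z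
    rw [hη, hF, hexp]
  · rw [hη, mul_div_cancel₀ _ hkR, hF₀]

/-- Loops covering the same injective loop have nested ranges as soon as these meet. -/
theorem range_subset_of_lifts_meet (hq : IsCoveringMapOn q s)
    {γ : C(Circle, X)} (hγ : Function.Injective γ) (hs : ∀ z, γ z ∈ s)
    {k₁ k₂ : ℕ} (hk₁ : k₁ ≠ 0) (hk₂ : k₂ ≠ 0) {η₁ η₂ : C(Circle, E)}
    (h₁ : ∀ z, q (η₁ z) = γ (z ^ k₁)) (h₂ : ∀ z, q (η₂ z) = γ (z ^ k₂))
    (hne : (range η₁ ∩ range η₂).Nonempty) : range η₁ ⊆ range η₂ := by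
  obtain ⟨_, ⟨z₁, rfl⟩, z₂, hz⟩ := hne
  obtain ⟨t₁, rfl⟩ := Circle.exp_surjective z₁
  obtain ⟨t₂, rfl⟩ := Circle.exp_surjective z₂
  have hk₁' : (k₁ : ℝ) ≠ 0 := by exact_mod_cast hk₁
  have hk₂' : (k₂ : ℝ) ≠ 0 := by exact_mod_cast hk₂
  have hpow : Circle.exp t₁ ^ k₁ = Circle.exp t₂ ^ k₂ := hγ (by rw [← h₁, ← h₂, hz])
  have hexp : ∀ {k : ℕ}, (k : ℝ) ≠ 0 → ∀ a t : ℝ,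
      Circle.exp (a + t / k) ^ k = Circle.exp a ^ k * Circle.exp t := fun {k} hk a t => by
    rw [Circle.exp_add, mul_pow, ← Circle.exp_nsmul, ← Circle.exp_nsmul,
      nsmul_eq_mul k (t / k), mul_div_cancel₀ _ hk]
  have hfun := hq.lift_real_unique (F := fun t => η₁ (Circle.exp (t₁ + t / k₁)))
    (G := fun t => η₂ (Circle.exp (t₂ + t / k₂))) (by fun_prop) (by fun_prop)
    (fun t => by rw [h₁, h₂, hexp hk₁', hexp hk₂', hpow]) (fun t => by rw [h₁]; exact hs _) 0
    (by simp [hz])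
  rintro _ ⟨z, rfl⟩
  obtain ⟨t, rfl⟩ := Circle.exp_surjective z
  have := congrFun hfun (k₁ * (t - t₁))
  simp only [mul_div_cancel_left₀ _ hk₁', add_sub_cancel] at this
  exact ⟨_, this.symm⟩

/-- The range of a loop covering an injective loop `γ` is a connected component of the preimage
of the range of `γ`. -/
theorem connectedComponentIn_eq_range_lift [T2Space E] (hq : IsCoveringMapOn q s)
    (hfin : ∀ x ∈ s, (q ⁻¹' {x}).Finite)
    {γ : C(Circle, X)} (hγ : Function.Injective γ) (hs : ∀ z, γ z ∈ s)
    {k : ℕ} (hk : k ≠ 0) {η : C(Circle, E)} (h : ∀ z, q (η z) = γ (z ^ k))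
    {e : E} (he : e ∈ range η) : connectedComponentIn (q ⁻¹' range γ) e = range η := by
  have hsub : range η ⊆ q ⁻¹' range γ := by
    rintro _ ⟨z, rfl⟩
    exact ⟨_, (h z).symm⟩
  refine subset_antisymm ?_
    ((isPreconnected_range η.continuous).subset_connectedComponentIn he hsub)
  have : Nonempty C(Circle, E) := ⟨η⟩
  choose! κ θ hκ _ hθ hmem using fun (x : E) (hx : q x ∈ range γ) =>
    hq.exists_circle_lift hfin hγ hs hx
  have hbase : ∀ x ∈ q ⁻¹' {γ 1}, q x ∈ range γ := fun x hx => ⟨1, hx.symm⟩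
  let B : Set E := ⋃ x ∈ q ⁻¹' {γ 1} \ range η, range (θ x)
  have hB : IsClosed B := ((hfin _ (hs 1)).subset sdiff_subset).isClosed_biUnion
    fun x _ => (isCompact_range (θ x).continuous).isClosed
  have hcover : q ⁻¹' range γ ⊆ range η ∪ B := fun x hx => by
    have hx1 : θ x 1 ∈ q ⁻¹' {γ 1} := by simp [hθ x hx]
    by_cases hxη : θ x 1 ∈ range η
    · exact .inl (hq.range_subset_of_lifts_meet hγ hs (hκ x hx) hk (hθ x hx) h
        ⟨_, mem_range_self 1, hxη⟩ (hmem x hx))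
    · exact .inr (mem_biUnion ⟨hx1, hxη⟩ (hq.range_subset_of_lifts_meet hγ hs (hκ x hx)
        (hκ _ (hbase _ hx1)) (hθ x hx) (hθ _ (hbase _ hx1))
        ⟨_, mem_range_self 1, hmem _ (hbase _ hx1)⟩ (hmem x hx)))
  have hdisj : range η ∩ B = ∅ := by
    refine eq_empty_of_forall_notMem fun y ⟨hy, hyB⟩ => ?_
    obtain ⟨x, ⟨hx1, hxη⟩, hyx⟩ := mem_iUnion₂.1 hyB
    have hx := hbase x hx1
    exact hxη (hq.range_subset_of_lifts_meet hγ hs (hκ x hx) hk (hθ x hx) h ⟨y, hyx, hy⟩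
      (hmem x hx))
  rcases isPreconnected_iff_subset_of_disjoint_closed.1 isPreconnected_connectedComponentIn
    _ B (isCompact_range η.continuous).isClosed hB
    ((connectedComponentIn_subset (q ⁻¹' range γ) e).trans hcover)
    (by rw [hdisj, inter_empty]) with h' | h'
  · exact h'
  · exact (eq_empty_iff_forall_notMem.1 hdisj e
      ⟨he, h' (mem_connectedComponentIn (hsub he))⟩).elim

end IsCoveringMapOn

/-- The iterate of the evaluation map is the evaluation map of an iterated composition. -/
theorem pIter_eq_eval (p : Polynomial ℂ) (n : ℕ) :
    pIter p n = fun z => (p.comp^[n] Polynomial.X).eval z := by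
  funext z
  rw [Polynomial.iterate_comp_eval, Polynomial.eval_X]
  rfl

/-- The critical values of the iterates of `p` are postcritical. -/
theorem pIter_mem_postCritical (p : Polynomial ℂ) (n : ℕ) {z : ℂ}
    (hz : (p.comp^[n] Polynomial.X).derivative.eval z = 0) : pIter p n z ∈ PostCritical p := by
  induction n with
  | zero => simp at hz
  | succ n ih =>
    rw [Function.iterate_succ_apply', Polynomial.derivative_comp, Polynomial.eval_mul,
      mul_eq_zero] at hz
    rcases hz with hz | hz
    · obtain ⟨m, w, hw, hwz⟩ := mem_iUnion.1 (ih hz)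
      refine mem_iUnion.2 ⟨m + 1, w, hw, ?_⟩
      change (fun z => p.eval z)^[m + 1 + 1] w = (fun z => p.eval z)^[n + 1] z
      rw [Function.iterate_succ_apply', Function.iterate_succ_apply' _ n]
      exact congrArg p.eval hwz
    · refine mem_iUnion.2 ⟨0, pIter p n z, ?_, ?_⟩
      · rw [Polynomial.eval_comp] at hz
        rwa [pIter_eq_eval]
      · exact (Function.iterate_succ_apply' _ _ _).symm

/-- The postcritical set is forward invariant. -/
theorem mapsTo_pIter_postCritical (p : Polynomial ℂ) (n : ℕ) :
    MapsTo (pIter p n) (PostCritical p) (PostCritical p) := by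
  intro z hz
  obtain ⟨m, w, hw, rfl⟩ := mem_iUnion.1 hz
  refine mem_iUnion.2 ⟨n + m, w, hw, ?_⟩
  exact Function.iterate_add_apply (fun z => p.eval z) n (m + 1) w

/-- The iterates of `p` are coverings over the complement of the postcritical set. -/
theorem isCoveringMapOn_pIter (p : Polynomial ℂ) (n : ℕ) :
    IsCoveringMapOn (pIter p n) (PostCritical p)ᶜ := by
  rw [pIter_eq_eval]
  refine (Polynomial.isCoveringMapOn_eval _).mono (compl_subset_compl.2 ?_)
  rintro _ ⟨z, hz, rfl⟩
  have := pIter_mem_postCritical p n hz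
  rwa [pIter_eq_eval] at this

/-- The fibers of the iterates of `p` off the postcritical set are finite. -/
theorem finite_pIter_fiber (p : Polynomial ℂ) (n : ℕ) {x : ℂ} (hx : x ∉ PostCritical p) :
    (pIter p n ⁻¹' {x}).Finite := by
  have hne : p.comp^[n] Polynomial.X ≠ Polynomial.C x := fun h => hx <| by
    have := pIter_mem_postCritical p n (z := 0) (by rw [h]; simp)
    simpa [pIter_eq_eval, h] using this
  rw [pIter_eq_eval, Polynomial.preimage_eval_singleton hne]
  exact Polynomial.rootSet_finite ..

theorem stmt11 (p : Polynomial ℂ) (d : ℕ) (hd : 2 ≤ d) (hdeg : p.natDegree = d)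
    (hpcf : (PostCritical p).Finite)
    (C C'' : Set ℂ) (hC : IsSCC (PostCritical p) C) (hC'' : IsSCC (PostCritical p) C'')
    (hhom : HomotopicIn (PostCritical p) C C'')
    (n : ℕ) (hn : 1 ≤ n) :
    ∀ η : Set ℂ, IsCompOf η (pIter p n ⁻¹' C) →
      ∃ η'' : Set ℂ, IsCompOf η'' (pIter p n ⁻¹' C'') ∧
        HomotopicIn (PostCritical p) η η'' := by
  rintro _ ⟨z, hz, rfl⟩
  obtain ⟨γ, γ', hγ, hγ', rfl, rfl, ⟨H⟩⟩ := hhom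
  have hq := isCoveringMapOn_pIter p n
  have hfin : ∀ x ∈ (PostCritical p)ᶜ, (pIter p n ⁻¹' {x}).Finite :=
    fun x hx => finite_pIter_fiber p n hx
  let ι : C(↥(PostCritical p)ᶜ, ℂ) := ⟨Subtype.val, continuous_subtype_val⟩
  have hι : Function.Injective ι := Subtype.val_injective
  obtain ⟨k, η, hk, hη, hqη, hzη⟩ := hq.exists_circle_lift hfin (γ := ι.comp γ)
    (hι.comp hγ) (fun w => (γ w).2) hz
  have hcomp : connectedComponentIn (pIter p n ⁻¹' range fun x => (γ x : ℂ)) z = range η :=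
    hq.connectedComponentIn_eq_range_lift hfin (γ := ι.comp γ) (hι.comp hγ)
      (fun w => (γ w).2) hk hqη hzη
  rw [hcomp]
  let Hk : C(unitInterval × Circle, ℂ) :=
    ⟨fun x => (H (x.1, x.2 ^ k) : ℂ), by fun_prop⟩
  obtain ⟨G, hG, hG0⟩ := hq.exists_homotopy_lift Hk (fun x => (H (x.1, x.2 ^ k)).2) η
    (fun w => by simp [Hk, hqη, ι])
  have hGP : ∀ x, G x ∉ PostCritical p := fun x hx =>
    (H (x.1, x.2 ^ k)).2 (by
      have := mapsTo_pIter_postCritical p n hx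
      rwa [hG] at this)
  let η' : C(Circle, ℂ) := ⟨fun w => G (1, w), by fun_prop⟩
  have hqη' : ∀ w, pIter p n (η' w) = ι.comp γ' (w ^ k) := fun w => by
    simp [η', hG, Hk, ι]
  have hη' : Function.Injective η' := fun v w hvw => by
    have hpow : v ^ k = w ^ k := hγ' (hι (by
      have := congrArg (pIter p n) hvw
      rwa [hqη', hqη'] at this))
    have hlift : (fun t : ℝ => G (projIcc 0 1 zero_le_one t, v)) =
        fun t : ℝ => G (projIcc 0 1 zero_le_one t, w) :=
      hq.lift_real_unique (by fun_prop) (by fun_prop)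
        (fun t => by simp [hG, Hk, hpow]) (fun t => by rw [hG]; exact (H _).2) 1
        (by simpa [η'] using hvw)
    have := congrFun hlift 0
    simp only [projIcc_left] at this
    exact hη (by rw [← hG0, ← hG0]; exact this)
  refine ⟨range η', ⟨η' 1, ⟨1, ?_⟩, ?_⟩, ⟨fun w => ⟨η w, by rw [← hG0]; exact hGP _⟩, by fun_prop⟩,
    ⟨fun w => ⟨η' w, hGP _⟩, by fun_prop⟩, fun v w h => hη (congrArg Subtype.val h),
    fun v w h => hη' (congrArg Subtype.val h), rfl, rfl, ⟨?_⟩⟩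
  · simp [hqη', ι]
  · exact (hq.connectedComponentIn_eq_range_lift hfin (γ := ι.comp γ') (hι.comp hγ')
      (fun w => (γ' w).2) hk hqη' (mem_range_self 1)).symm
  · exact
      { toFun := fun x => ⟨G x, hGP x⟩
        continuous_toFun := by fun_prop
        map_zero_left := fun w => Subtype.ext (hG0 w)
        map_one_left := fun w => rfl }
end
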